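/- Fix an integer r ≥ 2 and a function assigning to every graph G on [n] a maximum r-cut Π_G of G, and define eq_{−1}^r(G) := int(Π_G). Let N = C(n,2), let G_1 ~ G(n,m) and G_2 ~ G(n,m+1) for some m ∈ {0, …, N−1}. Then for every integer d ≥ −1 and all sufficiently large n: E|eq_{d+1}^r(G_1)| ≥ E|eq_d^r(G_2)| − 2n^{9/2}/(√(m+1)·(N − m)). -/

import Mathlib

open scoped Classical

noncomputable section

/-- The possible edges of a graph on vertex set `Fin n`. -/
abbrev EdgeType (n : ℕ) := {e : Sym2 (Fin n) // ¬ e.IsDiag}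

/-- A graph on vertex set `Fin n`, identified with its edge set. -/
abbrev FinGraph (n : ℕ) := Finset (EdgeType n)

/-- The size of the `r`-cut given by `φ` in `G`. -/
def cutSize {n r : ℕ} (φ : Fin n → Fin r) (G : FinGraph n) : ℕ :=
  (G.filter fun e => ¬ (Sym2.map φ (e : Sym2 (Fin n))).IsDiag).card

/-- The maximum size of an `r`-cut of `G`. -/
def maxCut (n r : ℕ) (G : FinGraph n) : ℕ :=
  Finset.univ.sup fun φ : Fin n → Fin r => cutSize φ G

/-- The deficit of the `r`-cut `φ` in `G`. -/
def deficit {n : ℕ} (r : ℕ) (φ : Fin n → Fin r) (G : FinGraph n) : ℕ :=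
  maxCut n r G - cutSize φ G

/-- The set of pairs of `(d,r)`-equivalent vertices of `G`. -/
def eqPairs {n : ℕ} (d r : ℕ) (G : FinGraph n) : Finset (EdgeType n) :=
  Finset.univ.filter fun e =>
    ∀ φ : Fin n → Fin r, deficit r φ G ≤ d → (Sym2.map φ (e : Sym2 (Fin n))).IsDiag

/-- `eq_d^r(G)` for `d ≥ -1`, where for `d = -1` it is the set `int(Π_G)` of pairs lying in
the same part of the selected maximum `r`-cut `Π_G` of `G`. -/
def eqPairsZ {n : ℕ} (r : ℕ) (Pi : FinGraph n → (Fin n → Fin r)) (d : ℤ) (G : FinGraph n) :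
    Finset (EdgeType n) :=
  if d < 0 then
    Finset.univ.filter fun e => (Sym2.map (Pi G) (e : Sym2 (Fin n))).IsDiag
  else eqPairs d.toNat r G

/-- Expectation of `f` under the uniform random graph `G(n,m)`. -/
def exGnm (n m : ℕ) (f : FinGraph n → ℝ) : ℝ :=
  (∑ G ∈ Finset.univ.filter fun G : FinGraph n => G.card = m, f G) /
    ((Finset.univ.filter fun G : FinGraph n => G.card = m).card : ℝ)



/-- Double counting of pairs consisting of a set of size `m + 1` and one of its elements. -/
theorem sum_card_succ_sum_mem {ι : Type*} [Fintype ι] [DecidableEq ι] (m : ℕ) (F : Finset ι → ι → ℝ) :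
    ∑ G ∈ Finset.univ.filter (fun G : Finset ι => G.card = m + 1), ∑ e ∈ G, F (G.erase e) e =
      ∑ G ∈ Finset.univ.filter (fun G : Finset ι => G.card = m), ∑ e ∈ Gᶜ, F G e := by
  rw [Finset.sum_sigma', Finset.sum_sigma']
  refine Finset.sum_bij' (fun p _ => ⟨p.1.erase p.2, p.2⟩) (fun p _ => ⟨insert p.2 p.1, p.2⟩)
    ?_ ?_ ?_ ?_ ?_
  · rintro ⟨G, e⟩ h
    simp only [Finset.mem_sigma, Finset.mem_filter, Finset.mem_univ, true_and] at h
    simp [Finset.card_erase_of_mem h.2, h.1]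
  · rintro ⟨G, e⟩ h
    simp only [Finset.mem_sigma, Finset.mem_filter, Finset.mem_univ, true_and,
      Finset.mem_compl] at h
    simp [Finset.card_insert_of_notMem h.2, h.1]
  · rintro ⟨G, e⟩ h
    simp only [Finset.mem_sigma] at h
    simp [Finset.insert_erase h.2]
  · rintro ⟨G, e⟩ h
    simp only [Finset.mem_sigma, Finset.mem_compl] at h
    simp [Finset.erase_insert h.2]
  · rintro ⟨G, e⟩ h
    rfl

theorem card_filter_card_eq {ι : Type*} [Fintype ι] (m : ℕ) :
    (Finset.univ.filter (fun G : Finset ι => G.card = m)).card = (Fintype.card ι).choose m := by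
  rw [Finset.univ_filter_card_eq, Finset.card_powersetCard, Finset.card_univ]

theorem succ_mul_choose_succ_cast {N m : ℕ} (h : m ≤ N) :
    ((m : ℝ) + 1) * (N.choose (m + 1) : ℝ) = ((N : ℝ) - m) * (N.choose m : ℝ) := by
  have := Nat.choose_succ_right_eq N m
  rw [← Nat.cast_sub h]
  norm_cast
  linarith

/-- The total size of the intersections of a fixed set with all sets of size `m`. -/
theorem card_mul_sum_card_inter {ι : Type*} [Fintype ι] [DecidableEq ι] (B : Finset ι) (m : ℕ)
    (hm : m ≤ Fintype.card ι) :
    (Fintype.card ι : ℝ) *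
        ∑ G ∈ Finset.univ.filter (fun G : Finset ι => G.card = m), ((G ∩ B).card : ℝ) =
      m * B.card * (Fintype.card ι).choose m := by
  induction m with
  | zero => simp [Finset.filter_eq']
  | succ m ih =>
    have ih := ih (by omega)
    have h := sum_card_succ_sum_mem m (fun (_ : Finset ι) e => if e ∈ B then (1 : ℝ) else 0)
    have h1 : ∀ G : Finset ι, ∑ e ∈ G, (if e ∈ B then (1 : ℝ) else 0) = (G ∩ B).card := by
      intro G
      rw [← Finset.sum_filter, Finset.filter_mem_eq_inter]
      simp
    have h2 : ∀ G : Finset ι, ((Gᶜ ∩ B).card : ℝ) = B.card - (G ∩ B).card := by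
      intro G
      have := Finset.card_inter_add_card_sdiff B G
      rw [Finset.inter_comm, ← Finset.sdiff_eq_inter_compl, ← this, Finset.inter_comm]
      push_cast
      ring
    simp only [h1, h2] at h
    rw [h, Finset.sum_sub_distrib, mul_sub, ih, Finset.sum_const, card_filter_card_eq,
      nsmul_eq_mul]
    have h3 := succ_mul_choose_succ_cast (N := Fintype.card ι) (m := m) (by omega)
    push_cast
    linear_combination -(B.card : ℝ) * h3

/-- The moment generating function of a hypergeometric variable is bounded by that of the
binomial variable with the same mean. -/
theorem sum_pow_card_inter_le {ι : Type*} [Fintype ι] [DecidableEq ι] [Nonempty ι] (B : Finset ι) {x : ℝ}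
    (hx : 1 ≤ x) (m : ℕ) (hm : m ≤ Fintype.card ι) :
    ∑ G ∈ Finset.univ.filter (fun G : Finset ι => G.card = m), x ^ (G ∩ B).card ≤
      (Fintype.card ι).choose m * (1 + (x - 1) * (B.card / Fintype.card ι)) ^ m := by
  induction m with
  | zero => simp [Finset.filter_eq']
  | succ m ih =>
    have ih := ih (by omega)
    set N := Fintype.card ι with hN
    have hN0 : (0 : ℝ) < N := by exact_mod_cast Fintype.card_pos
    have hmN : (m : ℝ) + 1 ≤ N := by exact_mod_cast hm
    set 𝒢 := Finset.univ.filter (fun G : Finset ι => G.card = m) with h𝒢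
    have h := sum_card_succ_sum_mem m
      (fun (G : Finset ι) e => x ^ (G ∩ B).card * (if e ∈ B then x else 1))
    have h1 : ∀ G ∈ Finset.univ.filter (fun G : Finset ι => G.card = m + 1),
        ∑ e ∈ G, x ^ (G.erase e ∩ B).card * (if e ∈ B then x else 1) =
          (m + 1) * x ^ (G ∩ B).card := by
      intro G hG
      have hG : G.card = m + 1 := by simpa using hG
      rw [Finset.sum_congr rfl (g := fun _ => x ^ (G ∩ B).card), Finset.sum_const, hG, nsmul_eq_mul]
      · push_cast; rfl
      · intro e he
        rw [Finset.erase_inter]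
        split_ifs with hB
        · rw [← pow_succ, Finset.card_erase_add_one (by simp [he, hB])]
        · rw [Finset.erase_eq_of_notMem (by simp [hB]), mul_one]
    have h2 : ∀ G ∈ 𝒢, ∑ e ∈ Gᶜ, x ^ (G ∩ B).card * (if e ∈ B then x else 1) =
        ((N - m) + (x - 1) * B.card) * x ^ (G ∩ B).card
          - (x - 1) * ((G ∩ B).card * x ^ (G ∩ B).card) := by
      intro G hG
      have hG : G.card = m := by simpa [h𝒢] using hG
      have h3 : ∀ e, (if e ∈ B then x else 1) = 1 + (x - 1) * (if e ∈ B then 1 else 0) := by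
        intro e
        split_ifs <;> ring
      have h4 : ((Gᶜ ∩ B).card : ℝ) = B.card - (G ∩ B).card := by
        have := Finset.card_inter_add_card_sdiff B G
        rw [Finset.inter_comm, ← Finset.sdiff_eq_inter_compl, ← this, Finset.inter_comm]
        push_cast
        ring
      have h5 : ((Gᶜ).card : ℝ) = N - m := by
        rw [Finset.card_compl, hG, Nat.cast_sub (by omega)]
      rw [← Finset.mul_sum, Finset.sum_congr rfl fun e _ => h3 e, Finset.sum_add_distrib,
        ← Finset.mul_sum, ← Finset.sum_filter, Finset.filter_mem_eq_inter]
      simp only [Finset.sum_const, nsmul_eq_mul, mul_one, h4, h5]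
      ring
    rw [Finset.sum_congr rfl h1, Finset.sum_congr rfl h2, ← Finset.mul_sum,
      Finset.sum_sub_distrib, ← Finset.mul_sum, ← Finset.mul_sum] at h
    have hmono : MonovaryOn (fun G : Finset ι => ((G ∩ B).card : ℝ))
        (fun G : Finset ι => x ^ (G ∩ B).card) (𝒢 : Set (Finset ι)) := by
      intro G _ H _ hlt
      by_contra hcon
      have : (H ∩ B).card ≤ (G ∩ B).card := by
        have := (not_le.1 hcon).le
        simpa using this
      exact absurd (pow_le_pow_right₀ hx this) (not_le.2 hlt)
    have hcheb := hmono.sum_mul_sum_le_card_mul_sum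
    have hmean := card_mul_sum_card_inter B m (by omega)
    rw [card_filter_card_eq, ← hN] at hcheb
    rw [← hN, ← h𝒢] at hmean
    set S := ∑ G ∈ 𝒢, x ^ (G ∩ B).card
    set T := ∑ G ∈ 𝒢, ((G ∩ B).card : ℝ)
    set U := ∑ G ∈ 𝒢, ((G ∩ B).card : ℝ) * x ^ (G ∩ B).card
    have hC : (0 : ℝ) < N.choose m := by exact_mod_cast Nat.choose_pos (by omega)
    have hU : m * (B.card / N) * S ≤ U := by
      have hT : T = N.choose m * (m * (B.card / N)) := by
        field_simp
        linarith
      rw [hT, mul_assoc] at hcheb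
      exact le_of_mul_le_mul_left hcheb hC
    have hq : 0 ≤ 1 + (x - 1) * (B.card / N) := by
      have : 0 ≤ (x - 1) * ((B.card : ℝ) / N) := mul_nonneg (by linarith) (by positivity)
      linarith
    have hsucc := succ_mul_choose_succ_cast (N := N) (m := m) (by omega)
    set q := 1 + (x - 1) * ((B.card : ℝ) / N) with hqdef
    have hid : ((N : ℝ) - m + (x - 1) * B.card) * S - (x - 1) * (m * (B.card / N) * S) =
        (N - m) * q * S := by
      rw [hqdef]
      field_simp
      ring
    have hm1 : (0 : ℝ) < m + 1 := by positivity
    refine le_of_mul_le_mul_left ?_ hm1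
    calc _ = _ := h
      _ ≤ ((N : ℝ) - m + (x - 1) * B.card) * S - (x - 1) * (m * (B.card / N) * S) := by
        have := mul_le_mul_of_nonneg_left hU (sub_nonneg.2 hx)
        linarith
      _ = (N - m) * q * S := hid
      _ ≤ (N - m) * q * (N.choose m * q ^ m) :=
        mul_le_mul_of_nonneg_left ih (mul_nonneg (by linarith) hq)
      _ = _ := by
        rw [pow_succ]
        linear_combination -(q ^ m * q) * hsucc

/-- The pairs of vertices to which `f` assigns different labels. -/
def crossing {n : ℕ} {α : Type*} (f : Fin n → α) : FinGraph n :=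
  Finset.univ.filter fun e => ¬ (Sym2.map f (e : Sym2 (Fin n))).IsDiag

theorem mem_crossing {n : ℕ} {α : Type*} (f : Fin n → α) (e : EdgeType n) :
    e ∈ crossing f ↔ ¬ (Sym2.map f (e : Sym2 (Fin n))).IsDiag := by
  simp [crossing]

/-- The largest excess, over density `p`, of the number of edges of `G` in a bipartite cut. -/
def cutExcess (n : ℕ) (p : ℝ) (G : FinGraph n) : ℝ :=
  Finset.univ.sup' Finset.univ_nonempty fun σ : Fin n → Bool =>
    ((G ∩ crossing σ).card : ℝ) - p * (crossing σ).card

theorem two_mul_card_ne {α : Type*} [Fintype α] {a b : α} (hab : a ≠ b) :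
    2 * (Finset.univ.filter fun c : α → Bool => c a ≠ c b).card =
      Fintype.card (α → Bool) := by
  have h : (Finset.univ.filter fun c : α → Bool => c a ≠ c b).card =
      (Finset.univ.filter fun c : α → Bool => ¬ (c a ≠ c b)).card := by
    refine Finset.card_nbij' (fun c => Function.update c a (!c a))
      (fun c => Function.update c a (!c a)) ?_ ?_ ?_ ?_
    · intro c hc
      simpa [Function.update_of_ne hab.symm, Bool.not_eq, Bool.eq_not] using hc
    · intro c hc
      simpa [Function.update_of_ne hab.symm, Bool.not_eq] using hc
    · intro c _
      simp
    · intro c _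
      simp
  have h2 := Finset.card_filter_add_card_filter_not (s := Finset.univ)
    (fun c : α → Bool => c a ≠ c b)
  rw [Finset.card_univ] at h2
  omega

/-- A uniformly random `2`-colouring of the labels cuts half of the crossing pairs. -/
theorem two_mul_sum_card_inter_crossing {n : ℕ} {α : Type*} [Fintype α] (f : Fin n → α)
    (H : FinGraph n) :
    2 * ∑ c : α → Bool, (H ∩ crossing (c ∘ f)).card =
      Fintype.card (α → Bool) * (H ∩ crossing f).card := by
  have h1 : ∀ K : FinGraph n, (H ∩ K).card = ∑ e ∈ H, if e ∈ K then 1 else 0 := by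
    intro K
    rw [← Finset.filter_mem_eq_inter, Finset.card_filter]
  simp only [h1]
  rw [Finset.sum_comm, Finset.mul_sum, Finset.mul_sum]
  refine Finset.sum_congr rfl ?_
  rintro ⟨e, he⟩ -
  rw [← Finset.card_filter]
  induction e using Sym2.ind with
  | _ u v =>
    simp only [mem_crossing, Sym2.map_mk, Sym2.mk_isDiag_iff, Function.comp]
    by_cases huv : f u = f v
    · simp [huv]
    · rw [if_pos huv, mul_one]
      exact two_mul_card_ne huv

theorem card_inter_crossing_sub_le {n : ℕ} {α : Type*} [Fintype α] (f : Fin n → α) (p : ℝ)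
    (G : FinGraph n) :
    ((G ∩ crossing f).card : ℝ) - p * (crossing f).card ≤ 2 * cutExcess n p G := by
  have hG : (2 : ℝ) * ∑ c : α → Bool, ((G ∩ crossing (c ∘ f)).card : ℝ) =
      Fintype.card (α → Bool) * (G ∩ crossing f).card := by
    exact_mod_cast two_mul_sum_card_inter_crossing f G
  have hU : (2 : ℝ) * ∑ c : α → Bool, ((crossing (c ∘ f)).card : ℝ) =
      Fintype.card (α → Bool) * (crossing f).card := by
    have := two_mul_sum_card_inter_crossing f Finset.univ
    simp only [Finset.univ_inter] at this
    exact_mod_cast this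
  have hle : ∑ c : α → Bool, (((G ∩ crossing (c ∘ f)).card : ℝ) - p * (crossing (c ∘ f)).card) ≤
      ∑ _c : α → Bool, cutExcess n p G :=
    Finset.sum_le_sum fun c _ => Finset.le_sup' (fun σ : Fin n → Bool =>
      ((G ∩ crossing σ).card : ℝ) - p * (crossing σ).card) (Finset.mem_univ (c ∘ f))
  rw [Finset.sum_sub_distrib, ← Finset.mul_sum, Finset.sum_const, Finset.card_univ,
    nsmul_eq_mul] at hle
  have hpos : (0 : ℝ) < Fintype.card (α → Bool) := by exact_mod_cast Fintype.card_pos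
  refine le_of_mul_le_mul_left ?_ hpos
  linear_combination 2 * hle - hG + p * hU

theorem card_edgeType (n : ℕ) : Fintype.card (EdgeType n) = n.choose 2 := by
  have := Sym2.card_subtype_not_diag (α := Fin n)
  rw [Fintype.card_fin] at this
  convert this

theorem exGnm_mul (n m : ℕ) (hm : m ≤ n.choose 2) (f : FinGraph n → ℝ) :
    (n.choose 2).choose m * exGnm n m f =
      ∑ G ∈ Finset.univ.filter (fun G : FinGraph n => G.card = m), f G := by
  have hC : (0 : ℝ) < (n.choose 2).choose m := by exact_mod_cast Nat.choose_pos hm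
  rw [exGnm, card_filter_card_eq, card_edgeType]
  field_simp

theorem sum_exp_card_inter_le {n m : ℕ} (hn : 2 ≤ n) (hm : m ≤ n.choose 2) (B : FinGraph n)
    {s : ℝ} (hs0 : 0 ≤ s) (hs1 : s ≤ 1) :
    ∑ G ∈ Finset.univ.filter (fun G : FinGraph n => G.card = m),
        Real.exp (s * ((G ∩ B).card - (m / n.choose 2 : ℝ) * B.card)) ≤
      (n.choose 2).choose m * Real.exp (m * s ^ 2) := by
  have hN : (0 : ℝ) < n.choose 2 := by exact_mod_cast Nat.choose_pos hn
  have : Nonempty (EdgeType n) := by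
    rw [← Fintype.card_pos_iff, card_edgeType]
    exact Nat.choose_pos hn
  have h := sum_pow_card_inter_le B (Real.one_le_exp hs0) m (by rwa [card_edgeType])
  rw [card_edgeType] at h
  set β : ℝ := B.card / n.choose 2 with hβ
  have hβ0 : 0 ≤ β := by positivity
  have hβ1 : β ≤ 1 := by
    rw [hβ, div_le_one hN, ← card_edgeType]
    exact_mod_cast Finset.card_le_univ B
  have hexp : Real.exp s - 1 - s ≤ s ^ 2 :=
    (le_abs_self _).trans (Real.abs_exp_sub_one_sub_id_le (by rwa [abs_of_nonneg hs0]))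
  have hterm : ∀ G : FinGraph n,
      Real.exp (s * ((G ∩ B).card - (m / n.choose 2 : ℝ) * B.card)) =
        Real.exp (-(m * β * s)) * Real.exp s ^ (G ∩ B).card := by
    intro G
    rw [← Real.exp_nat_mul, ← Real.exp_add, hβ]
    congr 1
    ring
  rw [Finset.sum_congr rfl fun G _ => hterm G, ← Finset.mul_sum]
  have hq0 : 0 ≤ 1 + (Real.exp s - 1) * β := by
    have := mul_nonneg (sub_nonneg.2 (Real.one_le_exp hs0)) hβ0
    linarith
  have hpow : (1 + (Real.exp s - 1) * β) ^ m ≤ Real.exp (m * ((Real.exp s - 1) * β)) := by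
    rw [Real.exp_nat_mul]
    refine pow_le_pow_left₀ hq0 ?_ m
    linarith [Real.add_one_le_exp ((Real.exp s - 1) * β)]
  calc _ ≤ Real.exp (-(m * β * s)) *
        ((n.choose 2).choose m * Real.exp (m * ((Real.exp s - 1) * β))) := by
        gcongr
        exact h.trans (by gcongr)
    _ = (n.choose 2).choose m * Real.exp (m * (β * (Real.exp s - 1 - s))) := by
        rw [mul_left_comm, ← Real.exp_add]
        congr 2
        ring
    _ ≤ _ := by
        gcongr
        calc β * (Real.exp s - 1 - s) ≤ β * s ^ 2 := by gcongr
          _ ≤ 1 * s ^ 2 := by gcongr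
          _ = s ^ 2 := one_mul _

theorem exGnm_cutExcess_le {n m : ℕ} (hn : 2 ≤ n) (hnm : n ≤ m) (hm : m ≤ n.choose 2) :
    exGnm n m (cutExcess n (m / n.choose 2)) ≤ 2 * Real.sqrt (n * m) := by
  have hn0 : (0 : ℝ) < n := by positivity
  have hm0 : (0 : ℝ) < m := by exact_mod_cast (by omega : 0 < m)
  have hC : (0 : ℝ) < (n.choose 2).choose m := by exact_mod_cast Nat.choose_pos hm
  set s : ℝ := Real.sqrt n / Real.sqrt m with hs
  have hsn : 0 < Real.sqrt n := Real.sqrt_pos.2 hn0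
  have hsm : 0 < Real.sqrt m := Real.sqrt_pos.2 hm0
  have hs0 : 0 < s := by positivity
  have hs1 : s ≤ 1 := by
    rw [hs, div_le_one hsm]
    exact Real.sqrt_le_sqrt (by exact_mod_cast hnm)
  have hms : m * s ^ 2 = n := by
    rw [hs, div_pow, Real.sq_sqrt hn0.le, Real.sq_sqrt hm0.le]
    field_simp
  have hpt : ∀ G : FinGraph n, s * cutExcess n (m / n.choose 2) G ≤
      2 * n - 1 + Real.exp (-(2 * n)) * ∑ σ : Fin n → Bool,
        Real.exp (s * ((G ∩ crossing σ).card - (m / n.choose 2 : ℝ) * (crossing σ).card)) := by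
    intro G
    obtain ⟨σ, -, hσ⟩ := Finset.exists_mem_eq_sup' (Finset.univ_nonempty)
      (fun σ : Fin n → Bool =>
        ((G ∩ crossing σ).card : ℝ) - (m / n.choose 2 : ℝ) * (crossing σ).card)
    have h1 := Finset.single_le_sum (s := Finset.univ) (f := fun σ : Fin n → Bool =>
      Real.exp (s * ((G ∩ crossing σ).card - (m / n.choose 2 : ℝ) * (crossing σ).card)))
      (fun _ _ => (Real.exp_pos _).le) (Finset.mem_univ σ)
    rw [cutExcess, hσ]
    set y : ℝ := s * (((G ∩ crossing σ).card : ℝ) - (m / n.choose 2 : ℝ) * (crossing σ).card)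
    have h2 := Real.add_one_le_exp (-(2 * n) + y)
    rw [Real.exp_add] at h2
    have h3 := mul_le_mul_of_nonneg_left h1 (Real.exp_pos (-(2 * (n : ℝ)))).le
    linarith
  have hsum := Finset.sum_le_sum
    (fun G (_ : G ∈ Finset.univ.filter (fun G : FinGraph n => G.card = m)) => hpt G)
  rw [← Finset.mul_sum, ← exGnm_mul n m hm, Finset.sum_add_distrib, Finset.sum_const,
    card_filter_card_eq, card_edgeType, nsmul_eq_mul, ← Finset.mul_sum, Finset.sum_comm] at hsum
  have hmgf : ∑ σ : Fin n → Bool, ∑ G ∈ Finset.univ.filter (fun G : FinGraph n => G.card = m),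
      Real.exp (s * ((G ∩ crossing σ).card - (m / n.choose 2 : ℝ) * (crossing σ).card)) ≤
      Real.exp (2 * n) * (n.choose 2).choose m := by
    calc _ ≤ ∑ σ : Fin n → Bool, ((n.choose 2).choose m : ℝ) * Real.exp (m * s ^ 2) :=
          Finset.sum_le_sum fun σ _ => sum_exp_card_inter_le hn hm _ hs0.le hs1
      _ = 2 ^ n * Real.exp n * (n.choose 2).choose m := by
          rw [hms, Finset.sum_const, Finset.card_univ, nsmul_eq_mul]
          simp
          ring
      _ ≤ Real.exp n * Real.exp n * (n.choose 2).choose m := by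
          gcongr
          calc (2 : ℝ) ^ n ≤ Real.exp 1 ^ n := by
                gcongr
                linarith [Real.add_one_le_exp 1]
            _ = Real.exp n := by rw [← Real.exp_nat_mul, mul_one]
      _ = _ := by
          rw [← Real.exp_add]
          ring_nf
  have h4 := mul_le_mul_of_nonneg_left hmgf (Real.exp_pos (-(2 * (n : ℝ)))).le
  rw [← mul_assoc, ← Real.exp_add, neg_add_cancel, Real.exp_zero, one_mul] at h4
  have h5 : ((n.choose 2).choose m : ℝ) * (s * exGnm n m (cutExcess n (m / n.choose 2))) ≤
      (n.choose 2).choose m * (2 * n) := by linarith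
  have h6 := le_of_mul_le_mul_left h5 hC
  refine le_of_mul_le_mul_left (h6.trans_eq ?_) hs0
  rw [Real.sqrt_mul hn0.le, hs]
  have : Real.sqrt n * Real.sqrt n = n := Real.mul_self_sqrt hn0.le
  field_simp
  linarith

theorem eqPairsZ_eq_compl_crossing {n r : ℕ} (Pi : FinGraph n → (Fin n → Fin r)) (d : ℤ)
    (G : FinGraph n) :
    ∃ (α : Type) (_ : Fintype α) (f : Fin n → α), eqPairsZ r Pi d G = (crossing f)ᶜ := by
  by_cases hd : d < 0
  · refine ⟨Fin r, inferInstance, Pi G, ?_⟩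
    ext e
    simp [eqPairsZ, hd, mem_crossing]
  · refine ⟨(Fin n → Fin r) → Option (Fin r), inferInstance,
      fun u φ => if deficit r φ G ≤ d.toNat then some (φ u) else none, ?_⟩
    ext ⟨e, he⟩
    induction e using Sym2.ind with
    | _ u v =>
      simp only [eqPairsZ, hd, if_false, eqPairs, Finset.mem_filter, Finset.mem_univ, true_and,
        Finset.mem_compl, mem_crossing, not_not, Sym2.map_mk, Sym2.mk_isDiag_iff, funext_iff]
      refine forall_congr' fun φ => ?_
      split_ifs with h <;> simp [h]

theorem mul_card_eqPairsZ_le {n r : ℕ} (hn : 2 ≤ n) (Pi : FinGraph n → (Fin n → Fin r)) (d : ℤ)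
    {m : ℕ} (G : FinGraph n) (hG : G.card = m) :
    (m / n.choose 2 : ℝ) * (eqPairsZ r Pi d G).card ≤
      (G ∩ eqPairsZ r Pi d G).card + 2 * cutExcess n (m / n.choose 2) G := by
  obtain ⟨α, _, f, hf⟩ := eqPairsZ_eq_compl_crossing Pi d G
  have hN : (0 : ℝ) < n.choose 2 := by exact_mod_cast Nat.choose_pos hn
  have h := card_inter_crossing_sub_le f (m / n.choose 2) G
  have h1 : ((crossing f)ᶜ.card : ℝ) = n.choose 2 - (crossing f).card := by
    rw [eq_sub_iff_add_eq, ← card_edgeType]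
    exact_mod_cast Finset.card_compl_add_card _
  have h2 : ((G ∩ (crossing f)ᶜ).card : ℝ) = m - (G ∩ crossing f).card := by
    rw [← Finset.sdiff_eq_inter_compl, eq_sub_iff_add_eq, ← hG]
    exact_mod_cast Finset.card_sdiff_add_card_inter _ _
  rw [hf, h1, h2, mul_sub, div_mul_cancel₀ _ hN.ne']
  linarith

theorem cutSize_eq_card_filter {n r : ℕ} (φ : Fin n → Fin r) (G : FinGraph n) :
    cutSize φ G =
      (Finset.filter (fun e : EdgeType n => ¬ (Sym2.map φ (e : Sym2 (Fin n))).IsDiag) G).card := by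
  unfold cutSize
  rw [← Finset.card_map (Function.Embedding.subtype _)]
  congr 1
  ext e
  simp [and_comm]

theorem cutSize_insert {n r : ℕ} (φ : Fin n → Fin r) {G : FinGraph n} {e : EdgeType n}
    (he : e ∉ G) :
    cutSize φ (insert e G) =
      cutSize φ G + if (Sym2.map φ (e : Sym2 (Fin n))).IsDiag then 0 else 1 := by
  rw [cutSize_eq_card_filter, cutSize_eq_card_filter, Finset.filter_insert]
  split_ifs with h
  · simp
  · rw [Finset.card_insert_of_notMem (by simp [he])]

theorem cutSize_le_maxCut {n r : ℕ} (φ : Fin n → Fin r) (G : FinGraph n) :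
    cutSize φ G ≤ maxCut n r G :=
  Finset.le_sup (f := fun φ : Fin n → Fin r => cutSize φ G) (Finset.mem_univ φ)

/-- If the endpoints of a new edge are equivalent after adding it, then they were
equivalent, with the allowed deficit one larger, before. -/
theorem mem_eqPairsZ_succ_of_mem_insert {n r : ℕ} (Pi : FinGraph n → (Fin n → Fin r))
    (hPi : ∀ G : FinGraph n, cutSize (Pi G) G = maxCut n r G) {d : ℤ} (hd : -1 ≤ d)
    {G : FinGraph n} {e : EdgeType n} (he : e ∉ G) (h : e ∈ eqPairsZ r Pi d (insert e G)) :
    e ∈ eqPairsZ r Pi (d + 1) G := by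
  have hdiag : (Sym2.map (Pi (insert e G)) (e : Sym2 (Fin n))).IsDiag := by
    unfold eqPairsZ at h
    split_ifs at h with hd0
    · simpa using h
    · simp only [eqPairs, Finset.mem_filter, Finset.mem_univ, true_and] at h
      exact h _ (by simp [deficit, hPi])
  have hmax : maxCut n r (insert e G) ≤ maxCut n r G := by
    rw [← hPi, cutSize_insert _ he, if_pos hdiag]
    exact cutSize_le_maxCut _ _
  simp only [eqPairsZ, not_lt.2 (by omega : 0 ≤ d + 1), if_false, eqPairs, Finset.mem_filter,
    Finset.mem_univ, true_and]
  intro φ hφ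
  by_contra hcut
  have hins := cutSize_insert φ he
  rw [if_neg hcut] at hins
  have hle := cutSize_le_maxCut φ (insert e G)
  unfold deficit at hφ
  by_cases hd0 : d < 0
  · omega
  · simp only [eqPairsZ, hd0, if_false, eqPairs, Finset.mem_filter, Finset.mem_univ, true_and] at h
    exact hcut (h φ (by unfold deficit; omega))

theorem exGnm_mono {n m : ℕ} {f g : FinGraph n → ℝ} (h : ∀ G, f G ≤ g G) :
    exGnm n m f ≤ exGnm n m g := by
  unfold exGnm
  gcongr with G
  exact h G

theorem exGnm_const {n m : ℕ} (hm : m ≤ n.choose 2) (c : ℝ) :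
    exGnm n m (fun _ => c) = c := by
  have hC : (0 : ℝ) < (n.choose 2).choose m := by exact_mod_cast Nat.choose_pos hm
  refine mul_left_cancel₀ hC.ne' ?_
  rw [exGnm_mul n m hm, Finset.sum_const, card_filter_card_eq, card_edgeType, nsmul_eq_mul]

/-- The expected number of equivalent pairs decreases by at most the discrepancy of cuts. -/
theorem exGnm_eqPairsZ_sub_le {n r m : ℕ} (hn : 2 ≤ n) (Pi : FinGraph n → (Fin n → Fin r))
    (hPi : ∀ G : FinGraph n, cutSize (Pi G) G = maxCut n r G) (hm : m + 1 ≤ n.choose 2)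
    {d : ℤ} (hd : -1 ≤ d) :
    exGnm n (m + 1) (fun G => ((eqPairsZ r Pi d G).card : ℝ)) -
        exGnm n m (fun G => ((eqPairsZ r Pi (d + 1) G).card : ℝ)) ≤
      n.choose 2 / (m + 1) * (2 * exGnm n (m + 1) (cutExcess n ((m + 1 : ℕ) / n.choose 2))) +
        n.choose 2 / (n.choose 2 - m) * (2 * exGnm n m (cutExcess n (m / n.choose 2))) := by
  have hm' : m ≤ n.choose 2 := by omega
  have hcount := sum_card_succ_sum_mem m (fun (G : FinGraph n) e =>
    if e ∈ eqPairsZ r Pi d (insert e G) then (1 : ℝ) else 0)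
  have hleft : ∀ G : FinGraph n,
      ∑ e ∈ G, (if e ∈ eqPairsZ r Pi d (insert e (G.erase e)) then (1 : ℝ) else 0) =
        (G ∩ eqPairsZ r Pi d G).card := by
    intro G
    rw [← Finset.filter_mem_eq_inter, Finset.card_filter, Nat.cast_sum]
    refine Finset.sum_congr rfl fun e he => ?_
    rw [Finset.insert_erase he]
    simp
  have hright : ∀ G ∈ Finset.univ.filter (fun G : FinGraph n => G.card = m),
      ∑ e ∈ Gᶜ, (if e ∈ eqPairsZ r Pi d (insert e G) then (1 : ℝ) else 0) ≤
        (1 - m / n.choose 2) * (eqPairsZ r Pi (d + 1) G).card +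
          2 * cutExcess n (m / n.choose 2) G := by
    intro G hG
    have h1 := mul_card_eqPairsZ_le hn Pi (d + 1) G (by simpa using hG)
    have h2 : ((Gᶜ ∩ eqPairsZ r Pi (d + 1) G).card : ℝ) =
        (eqPairsZ r Pi (d + 1) G).card - (G ∩ eqPairsZ r Pi (d + 1) G).card := by
      rw [eq_sub_iff_add_eq, Finset.inter_comm, ← Finset.sdiff_eq_inter_compl, Finset.inter_comm G]
      exact_mod_cast Finset.card_sdiff_add_card_inter _ _
    have h3 : ∑ e ∈ Gᶜ, (if e ∈ eqPairsZ r Pi d (insert e G) then (1 : ℝ) else 0) ≤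
        (Gᶜ ∩ eqPairsZ r Pi (d + 1) G).card := by
      rw [← Finset.filter_mem_eq_inter, Finset.card_filter, Nat.cast_sum]
      refine Finset.sum_le_sum fun e he => ?_
      by_cases h : e ∈ eqPairsZ r Pi d (insert e G)
      · simp [h, mem_eqPairsZ_succ_of_mem_insert Pi hPi hd (Finset.mem_compl.1 he) h]
      · rw [if_neg h]
        positivity
    linarith
  have hleft' : ∀ G ∈ Finset.univ.filter (fun G : FinGraph n => G.card = m + 1),
      ((m + 1 : ℕ) / n.choose 2 : ℝ) * (eqPairsZ r Pi d G).card -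
        2 * cutExcess n ((m + 1 : ℕ) / n.choose 2) G ≤ (G ∩ eqPairsZ r Pi d G).card := by
    intro G hG
    have h1 := mul_card_eqPairsZ_le hn Pi d G (m := m + 1) (by simpa using hG)
    linarith
  simp only [hleft] at hcount
  have hmain := (Finset.sum_le_sum hleft').trans (hcount.le.trans (Finset.sum_le_sum hright))
  rw [Finset.sum_sub_distrib, Finset.sum_add_distrib, ← Finset.mul_sum, ← Finset.mul_sum,
    ← Finset.mul_sum, ← Finset.mul_sum, ← exGnm_mul n _ hm', ← exGnm_mul n _ hm',
    ← exGnm_mul n _ hm, ← exGnm_mul n _ hm] at hmain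
  have hsucc := succ_mul_choose_succ_cast hm'
  have hC : (0 : ℝ) < (n.choose 2).choose m := by exact_mod_cast Nat.choose_pos hm'
  have hmN : (m : ℝ) + 1 ≤ n.choose 2 := by exact_mod_cast hm
  set D₂ := exGnm n (m + 1) (cutExcess n ((m + 1 : ℕ) / n.choose 2))
  set D₁ := exGnm n m (cutExcess n (m / n.choose 2))
  set A₂ := exGnm n (m + 1) (fun G => ((eqPairsZ r Pi d G).card : ℝ))
  set A₁ := exGnm n m (fun G => ((eqPairsZ r Pi (d + 1) G).card : ℝ))
  push_cast at hmain
  generalize ((n.choose 2).choose m : ℝ) = C₁ at *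
  generalize ((n.choose 2).choose (m + 1) : ℝ) = C₂ at *
  generalize (n.choose 2 : ℝ) = N at *
  have hk : (0 : ℝ) < m + 1 := by positivity
  have hNm : 0 < N - m := by linarith
  have hN : 0 < N := by linarith
  have h1 := mul_le_mul_of_nonneg_left hmain hk.le
  have h2 : C₁ * ((N - m) * ((m + 1) / N * A₂ - 2 * D₂)) ≤
      C₁ * ((m + 1) * ((1 - m / N) * A₁ + 2 * D₁)) := by
    linear_combination h1 - ((m + 1) / N * A₂ - 2 * D₂) * hsucc
  have h3 := le_of_mul_le_mul_left h2 hC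
  have h4 : (m + 1) * (N - m) / N * (A₂ - A₁) ≤
      (m + 1) * (N - m) / N * (N / (m + 1) * (2 * D₂) + N / (N - m) * (2 * D₁)) := by
    have e1 : (m + 1) * (N - m) / N * (N / (m + 1) * (2 * D₂) + N / (N - m) * (2 * D₁)) =
        (N - m) * (2 * D₂) + (m + 1) * (2 * D₁) := by
      field_simp
    have e2 : (m + 1) * (N - m) / N * (A₂ - A₁) =
        (N - m) * ((m + 1) / N * A₂) - (m + 1) * ((1 - m / N) * A₁) := by
      field_simp
    rw [e1, e2]
    linarith
  exact le_of_mul_le_mul_left h4 (by positivity)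

/-- For `G₁ ~ G(n,m)`, `G₂ ~ G(n,m+1)`, every `d ≥ -1` and all sufficiently large `n`:
`E|eq_{d+1}^r(G₁)| ≥ E|eq_d^r(G₂)| - 2n^{9/2}/(√(m+1)(N-m))` where `N = C(n,2)`. -/
theorem eq_d_d_plus_one_clean :
    ∃ n₀ : ℕ, ∀ n : ℕ, n₀ ≤ n → ∀ r : ℕ, 2 ≤ r →
      ∀ Pi : FinGraph n → (Fin n → Fin r), (∀ G : FinGraph n, cutSize (Pi G) G = maxCut n r G) →
        ∀ m : ℕ, m + 1 ≤ n.choose 2 → ∀ d : ℤ, -1 ≤ d →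
          exGnm n (m + 1) (fun G => ((eqPairsZ r Pi d G).card : ℝ)) -
              2 * (n : ℝ) ^ ((9 : ℝ) / 2) /
                (Real.sqrt ((m : ℝ) + 1) * ((n.choose 2 : ℝ) - m)) ≤
            exGnm n m (fun G => ((eqPairsZ r Pi (d + 1) G).card : ℝ)) := by
  refine ⟨0, fun n _ r _ Pi hPi m hm d hd => ?_⟩
  have hn : 2 ≤ n := by
    by_contra h
    rw [Nat.choose_eq_zero_of_lt (by omega)] at hm
    omega
  have hn2 : (2 : ℝ) ≤ n := by exact_mod_cast hn
  have hmN : (m : ℝ) + 1 ≤ n.choose 2 := by exact_mod_cast hm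
  have hchoose : (n.choose 2 : ℝ) = n * (n - 1) / 2 := Nat.cast_choose_two ℝ n
  have hpow : (n : ℝ) ^ ((9 : ℝ) / 2) = n ^ 4 * Real.sqrt n := by
    rw [Real.sqrt_eq_rpow, ← Real.rpow_natCast, ← Real.rpow_add (by positivity)]
    norm_num
  have hs : 0 < Real.sqrt ((m : ℝ) + 1) := Real.sqrt_pos.2 (by positivity)
  have hss : Real.sqrt ((m : ℝ) + 1) * Real.sqrt ((m : ℝ) + 1) = m + 1 :=
    Real.mul_self_sqrt (by positivity)
  have hNm : (0 : ℝ) < n.choose 2 - m := by linarith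
  have hN : (0 : ℝ) < n.choose 2 := by linarith [(Nat.cast_nonneg m : (0 : ℝ) ≤ m)]
  have hm0 : (0 : ℝ) ≤ m := Nat.cast_nonneg m
  rw [hpow, sub_le_comm]
  by_cases hnm : n ≤ m
  · have h1 := exGnm_cutExcess_le hn hnm (by omega : m ≤ n.choose 2)
    have h2 := exGnm_cutExcess_le hn (by omega : n ≤ m + 1) hm
    have h3 : Real.sqrt (n * m) ≤ Real.sqrt n * Real.sqrt ((m : ℝ) + 1) := by
      rw [← Real.sqrt_mul (by positivity)]
      exact Real.sqrt_le_sqrt (by nlinarith)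
    have h4 : Real.sqrt (n * (m + 1 : ℕ)) = Real.sqrt n * Real.sqrt ((m : ℝ) + 1) := by
      rw [← Real.sqrt_mul (by positivity)]
      push_cast
      rfl
    rw [h4] at h2
    refine (exGnm_eqPairsZ_sub_le hn Pi hPi hm hd).trans ?_
    set t := Real.sqrt ((m : ℝ) + 1)
    set N := (n.choose 2 : ℝ)
    have h5 : 4 * N * (N + 1) ≤ 2 * (n : ℝ) ^ 4 := by
      have hle : 2 * (N + 1) ≤ (n : ℝ) ^ 2 := by
        rw [hchoose]
        linarith
      nlinarith [mul_le_mul hle hle (by positivity) (by positivity)]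
    calc _ ≤ N / (m + 1) * (2 * (2 * (Real.sqrt n * t))) +
          N / (N - m) * (2 * (2 * (Real.sqrt n * t))) := by
          gcongr
          exact h1.trans (by gcongr)
      _ = 4 * N * (N + 1) * Real.sqrt n / (t * (N - m)) := by
          rw [← hss]
          field_simp
          linear_combination 4 * hss
      _ ≤ _ := by
          gcongr ?_ / _
          rw [← mul_assoc]
          exact mul_le_mul_of_nonneg_right h5 (Real.sqrt_nonneg _)
  · have h1 : exGnm n (m + 1) (fun G => ((eqPairsZ r Pi d G).card : ℝ)) ≤ n.choose 2 := by
      rw [← exGnm_const hm (n.choose 2 : ℝ), ← card_edgeType]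
      exact exGnm_mono fun G => by exact_mod_cast Finset.card_le_univ _
    have h2 : 0 ≤ exGnm n m (fun G => ((eqPairsZ r Pi (d + 1) G).card : ℝ)) := by
      rw [← exGnm_const (by omega : m ≤ n.choose 2) (0 : ℝ)]
      exact exGnm_mono fun G => by positivity
    refine (by linarith : _ ≤ (n.choose 2 : ℝ)).trans ?_
    rw [le_div_iff₀ (by positivity)]
    have h3 : Real.sqrt ((m : ℝ) + 1) ≤ Real.sqrt n :=
      Real.sqrt_le_sqrt (by exact_mod_cast (by omega : m + 1 ≤ n))
    have hN2 : (n.choose 2 : ℝ) ≤ n ^ 2 := by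
      rw [hchoose]
      nlinarith
    calc (n.choose 2 : ℝ) * (Real.sqrt ((m : ℝ) + 1) * (n.choose 2 - m))
        ≤ n ^ 2 * (Real.sqrt n * n ^ 2) := by
          gcongr
          linarith
      _ ≤ 2 * (n ^ 4 * Real.sqrt n) := by
          have : 0 ≤ (n : ℝ) ^ 4 * Real.sqrt n := by positivity
          linear_combination this

end
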